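/- Suppose p(0) ∈ R₁ and the Eater plays π^{E*}. Then every admissible Mover strategy in game G_i yields J_i ≥ b_i(0) + d(p(0), g_i) = c_i(0), and the equilibrium Mover strategy π^{M*}_i achieves J_i = c_i(0); hence in R₁ the Mover has no incentive to deviate from π^{M*}_i. -/

import Mathlib

noncomputable section

open Classical

/-- Manhattan distance on the grid ℤ². -/
def mdist (p q : ℤ × ℤ) : ℤ := |p.1 - q.1| + |p.2 - q.2|

/-- The four admissible unit moves of the Mover. -/
def IsUnitMove (e : ℤ × ℤ) : Prop :=
  e = (1, 0) ∨ e = (-1, 0) ∨ e = (0, 1) ∨ e = (0, -1)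

/-- The Eater action that eats one banana from goal `j`. -/
def eatOne (j : Fin 2) : Fin 2 → ℝ := fun k => if k = j then 1 else 0

/-- The Eater action that eats half a banana from each goal. -/
def eatHalf : Fin 2 → ℝ := fun _ => 1 / 2

/-- The three admissible Eater actions. -/
def IsEaterAction (a : Fin 2 → ℝ) : Prop :=
  a = eatOne 0 ∨ a = eatOne 1 ∨ a = eatHalf

/-- A Mover strategy: maps (position, consumption vector) to a move. -/
abbrev MoverStrategy : Type := ℤ × ℤ → (Fin 2 → ℝ) → ℤ × ℤ

/-- An Eater strategy: maps (new Mover position, last Mover move, current consumption)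
to an Eater action; it is the same in both games. -/
abbrev EaterStrategy : Type := ℤ × ℤ → ℤ × ℤ → (Fin 2 → ℝ) → Fin 2 → ℝ

def ValidMover (piM : MoverStrategy) : Prop := ∀ p b, IsUnitMove (piM p b)

def ValidEater (piE : EaterStrategy) : Prop := ∀ p a b, IsEaterAction (piE p a b)

/-- State trajectory (position, consumption vector) of the game under a strategy pair:
`p(t+1) = p(t) + a^M(t)`, `b(t+1) = b(t) + a^E(t)`. -/
def traj (piM : MoverStrategy) (piE : EaterStrategy) (p0 : ℤ × ℤ) (b0 : Fin 2 → ℝ) :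
    ℕ → (ℤ × ℤ) × (Fin 2 → ℝ)
  | 0 => (p0, b0)
  | t + 1 =>
    let s := traj piM piE p0 b0 t
    let m := piM s.1 s.2
    (s.1 + m, fun j => s.2 j + piE (s.1 + m) m s.2 j)

/-- Termination time of game `G_i`: the first time the Mover's position equals `goal`. -/
def hitTime (piM : MoverStrategy) (piE : EaterStrategy) (p0 : ℤ × ℤ) (b0 : Fin 2 → ℝ)
    (goal : ℤ × ℤ) : ℕ :=
  sInf {t | (traj piM piE p0 b0 t).1 = goal}

/-- The outcome `J_i` of game `G_i`: consumption at the true goal `g i` at termination. -/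
def outcome (g : Fin 2 → ℤ × ℤ) (i : Fin 2) (piM : MoverStrategy) (piE : EaterStrategy)
    (p0 : ℤ × ℤ) (b0 : Fin 2 → ℝ) : ℝ :=
  (traj piM piE p0 b0 (hitTime piM piE p0 b0 (g i))).2 i

/-- Admissibility: the Mover reaches the goal in finite time. -/
def Reaches (piM : MoverStrategy) (piE : EaterStrategy) (p0 : ℤ × ℤ) (b0 : Fin 2 → ℝ)
    (goal : ℤ × ℤ) : Prop :=
  ∃ t, (traj piM piE p0 b0 t).1 = goal

/-- A step from `p` to `p'` is ambiguous: `δd₁ = δd₂`. -/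
def IsAmbStep (g : Fin 2 → ℤ × ℤ) (p p' : ℤ × ℤ) : Prop :=
  mdist p' (g 0) - mdist p (g 0) = mdist p' (g 1) - mdist p (g 1)

/-- A step from `p` to `p'` is explicit: `δd₁ = −δd₂`. -/
def IsExpStep (g : Fin 2 → ℤ × ℤ) (p p' : ℤ × ℤ) : Prop :=
  mdist p' (g 0) - mdist p (g 0) = -(mdist p' (g 1) - mdist p (g 1))

/-- A path of `T` unit moves from `p` to `goal`. -/
def IsPath (p goal : ℤ × ℤ) (T : ℕ) (q : ℕ → ℤ × ℤ) : Prop :=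
  q 0 = p ∧ q T = goal ∧ ∀ t < T, IsUnitMove (q (t + 1) - q t)

/-- Number of ambiguous moves along a path. -/
def ambCount (g : Fin 2 → ℤ × ℤ) (T : ℕ) (q : ℕ → ℤ × ℤ) : ℕ :=
  ((Finset.range T).filter fun t => IsAmbStep g (q t) (q (t + 1))).card

/-- Number of explicit moves along a path. -/
def expCount (g : Fin 2 → ℤ × ℤ) (T : ℕ) (q : ℕ → ℤ × ℤ) : ℕ :=
  ((Finset.range T).filter fun t => IsExpStep g (q t) (q (t + 1))).card

/-- `n^a(p)`: minimum number of ambiguous moves over paths from `p` to a goal. -/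
def naN (g : Fin 2 → ℤ × ℤ) (p : ℤ × ℤ) : ℕ :=
  sInf {n : ℕ | ∃ i : Fin 2, ∃ T q, IsPath p (g i) T q ∧ ambCount g T q = n}

/-- `n^r_i(p)`: minimum number of explicit moves needed to reach `g i` from `p`. -/
def nrN (g : Fin 2 → ℤ × ℤ) (i : Fin 2) (p : ℤ × ℤ) : ℕ :=
  sInf {n : ℕ | ∃ T q, IsPath p (g i) T q ∧ expCount g T q = n}

/-- The equilibrium Eater strategy `π^{E*}`: after an ambiguous Mover move the
conservative action (based on the sign of `δ̃c₁`), after an explicit move the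
exploiting action (eat from the approached goal). -/
def piEstar (g : Fin 2 → ℤ × ℤ) : EaterStrategy := fun p' a b =>
  let p := p' - a
  let d1 := mdist p' (g 0) - mdist p (g 0)
  let d2 := mdist p' (g 1) - mdist p (g 1)
  if d1 = d2 then
    if (b 0 + (mdist p' (g 0) : ℝ)) - (b 1 + (mdist p' (g 1) : ℝ)) < 0 then eatOne 0
    else if 0 < (b 0 + (mdist p' (g 0) : ℝ)) - (b 1 + (mdist p' (g 1) : ℝ)) then eatOne 1
    else eatHalf
  else if d1 < d2 then eatOne 0
  else eatOne 1

/-- `π^{M*}_i`: the Mover strategy that (against any Eater strategy) follows a shortest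
path from `p0` to `g i`, performing all `n^a(p0)` ambiguous moves first and then the
explicit moves. -/
def IsMoverStar (g : Fin 2 → ℤ × ℤ) (i : Fin 2) (p0 : ℤ × ℤ) (b0 : Fin 2 → ℝ)
    (piM : MoverStrategy) : Prop :=
  ValidMover piM ∧
  ∀ piE : EaterStrategy, ValidEater piE →
    (traj piM piE p0 b0 (mdist p0 (g i)).toNat).1 = g i ∧
    ∀ t < (mdist p0 (g i)).toNat,
      (IsAmbStep g (traj piM piE p0 b0 t).1 (traj piM piE p0 b0 (t + 1)).1 ↔ t < naN g p0)

/-- `c_i(p, b) = b_i + d(p, g_i)`. -/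
def cval (g : Fin 2 → ℤ × ℤ) (i : Fin 2) (p : ℤ × ℤ) (b : Fin 2 → ℝ) : ℝ :=
  b i + (mdist p (g i) : ℝ)

/-- `δc_i = c_i − c_{3−i}`. -/
def dcval (g : Fin 2 → ℤ × ℤ) (i : Fin 2) (p : ℤ × ℤ) (b : Fin 2 → ℝ) : ℝ :=
  cval g i p b - cval g (1 - i) p b

end

lemma mdist_step (p e q : ℤ × ℤ) (h : IsUnitMove e) :
    mdist (p + e) q - mdist p q = 1 ∨ mdist (p + e) q - mdist p q = -1 := by
  obtain ⟨p1, p2⟩ := p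
  obtain ⟨q1, q2⟩ := q
  rcases h with rfl | rfl | rfl | rfl <;> simp only [mdist, Prod.mk_add_mk] <;> grind

lemma valid_piEstar (g : Fin 2 → ℤ × ℤ) : ValidEater (piEstar g) := by
  intro p a b
  unfold piEstar IsEaterAction
  dsimp only
  split_ifs <;> simp

lemma action_bounds (a : Fin 2 → ℝ) (h : IsEaterAction a) (i : Fin 2) : 0 ≤ a i ∧ a i ≤ 1 := by
  rcases h with rfl | rfl | rfl <;> fin_cases i <;> norm_num [eatOne, eatHalf]

lemma step_mono (g : Fin 2 → ℤ × ℤ) (i : Fin 2) (p m : ℤ × ℤ) (b : Fin 2 → ℝ)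
    (h : IsUnitMove m) :
    2 * cval g i p b - (mdist p (g 0) + mdist p (g 1) : ℤ) ≤
    2 * cval g i (p + m) (fun j => b j + piEstar g (p + m) m b j)
      - (mdist (p + m) (g 0) + mdist (p + m) (g 1) : ℤ) := by
  have hb := action_bounds _ (valid_piEstar g (p + m) m b) i
  have h0 := mdist_step p m (g 0) h
  have h1 := mdist_step p m (g 1) h
  have key : ∀ x y x' y' : ℤ, x' - x = y → x' - x = y' → (x' : ℝ) = x + y := by
    intro x y x' _ h _
    have : x' = x + y := by omega
    exact_mod_cast this
  rcases h0 with h0 | h0 <;> rcases h1 with h1 | h1 <;>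
    have e0 := key _ _ _ _ h0 h0 <;> have e1 := key _ _ _ _ h1 h1
  · fin_cases i <;> simp only [cval] <;> push_cast <;> simp at * <;> linarith
  · have : piEstar g (p + m) m b = eatOne 1 := by
      unfold piEstar; simp [h0, h1]
    rw [this]
    fin_cases i <;> simp [cval, eatOne, e0, e1] <;> linarith
  · have : piEstar g (p + m) m b = eatOne 0 := by
      unfold piEstar; simp [h0, h1]
    rw [this]
    fin_cases i <;> simp [cval, eatOne, e0, e1] <;> linarith
  · fin_cases i <;> simp only [cval] <;> push_cast <;> simp at * <;> linarith

lemma traj_mono (g : Fin 2 → ℤ × ℤ) (i : Fin 2) (p0 : ℤ × ℤ) (b0 : Fin 2 → ℝ)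
    (piM : MoverStrategy) (h : ValidMover piM) (t : ℕ) :
    2 * cval g i p0 b0 - (mdist p0 (g 0) + mdist p0 (g 1) : ℤ) ≤
    2 * cval g i (traj piM (piEstar g) p0 b0 t).1 (traj piM (piEstar g) p0 b0 t).2
      - (mdist (traj piM (piEstar g) p0 b0 t).1 (g 0)
        + mdist (traj piM (piEstar g) p0 b0 t).1 (g 1) : ℤ) := by
  induction t with
  | zero => exact le_rfl
  | succ t ih => exact ih.trans (step_mono g i _ _ _ (h _ _))

lemma traj_le (i : Fin 2) (p0 : ℤ × ℤ) (b0 : Fin 2 → ℝ)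
    (piM : MoverStrategy) (piE : EaterStrategy) (h : ValidEater piE) (t : ℕ) :
    (traj piM piE p0 b0 t).2 i ≤ b0 i + t := by
  induction t with
  | zero => simp [traj]
  | succ t ih =>
    have := (action_bounds _ (h ((traj piM piE p0 b0 t).1 +
      piM (traj piM piE p0 b0 t).1 (traj piM piE p0 b0 t).2)
      (piM (traj piM piE p0 b0 t).1 (traj piM piE p0 b0 t).2) (traj piM piE p0 b0 t).2) i).2
    simp only [traj]
    push_cast
    linarith

lemma lower_bound (g : Fin 2 → ℤ × ℤ) (p0 : ℤ × ℤ) (b0 : Fin 2 → ℝ)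
    (hR1 : mdist p0 (g 0) + mdist p0 (g 1) = mdist (g 0) (g 1)) (i : Fin 2)
    (piM : MoverStrategy) (hv : ValidMover piM) (hr : Reaches piM (piEstar g) p0 b0 (g i)) :
    cval g i p0 b0 ≤ outcome g i piM (piEstar g) p0 b0 := by
  have hT : (traj piM (piEstar g) p0 b0 (hitTime piM (piEstar g) p0 b0 (g i))).1 = g i :=
    Nat.sInf_mem (s := {t | (traj piM (piEstar g) p0 b0 t).1 = g i}) hr
  have hm := traj_mono g i p0 b0 piM hv (hitTime piM (piEstar g) p0 b0 (g i))
  have hs : mdist (g i) (g 0) + mdist (g i) (g 1) = mdist (g 0) (g 1) := by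
    fin_cases i
    · simp [mdist]
    · simp [mdist, abs_sub_comm]
  have hz : mdist (g i) (g i) = 0 := by simp [mdist]
  rw [hT, hR1, hs] at hm
  have : cval g i (g i) (traj piM (piEstar g) p0 b0 (hitTime piM (piEstar g) p0 b0 (g i))).2
      = outcome g i piM (piEstar g) p0 b0 := by
    simp [cval, outcome, hz]
  linarith

/-- in `R₁`, against `π^{E*}` every admissible Mover strategy yields
`J_i ≥ c_i(0)`, and `π^{M*}_i` achieves `J_i = c_i(0)`. -/
theorem mover_no_deviation_in_R1
    (g : Fin 2 → ℤ × ℤ) (hg : g 0 ≠ g 1) (p0 : ℤ × ℤ) (b0 : Fin 2 → ℝ)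
    (hb0 : ∀ j, 0 ≤ b0 j)
    (hR1 : mdist p0 (g 0) + mdist p0 (g 1) = mdist (g 0) (g 1)) (i : Fin 2) :
    (∀ piM : MoverStrategy, ValidMover piM → Reaches piM (piEstar g) p0 b0 (g i) →
      cval g i p0 b0 ≤ outcome g i piM (piEstar g) p0 b0) ∧
    (∀ piMstar : MoverStrategy, IsMoverStar g i p0 b0 piMstar →
      outcome g i piMstar (piEstar g) p0 b0 = cval g i p0 b0) := by
  refine ⟨fun piM hv hr => lower_bound g p0 b0 hR1 i piM hv hr, fun piM hs => ?_⟩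
  obtain ⟨hv, hs⟩ := hs
  have hit := (hs _ (valid_piEstar g)).1
  apply le_antisymm _ (lower_bound g p0 b0 hR1 i piM hv ⟨_, hit⟩)
  have hle : hitTime piM (piEstar g) p0 b0 (g i) ≤ (mdist p0 (g i)).toNat := Nat.sInf_le hit
  have hnn : 0 ≤ mdist p0 (g i) := by unfold mdist; positivity
  have hle2 : (hitTime piM (piEstar g) p0 b0 (g i) : ℤ) ≤ mdist p0 (g i) := by omega
  have hle3 : (hitTime piM (piEstar g) p0 b0 (g i) : ℝ) ≤ (mdist p0 (g i) : ℝ) := by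
    exact_mod_cast hle2
  have := traj_le i p0 b0 piM (piEstar g) (valid_piEstar g) (hitTime piM (piEstar g) p0 b0 (g i))
  unfold outcome cval
  linarith
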